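/- arXiv:2206.01026 — 2 statements merged into one kernel-verified Lean document; each statement's English description precedes it below -/
import Mathlib

section
/- Define F(p,s) = ∫_0^∞ |𝔧₁(t)|^s t^{p-1} dt, D(p) = Γ(3-p) / ( Γ(2 - p/2)² Γ(3 - p/2) ), and G̃(p,s) = s^{-p/2} 2^{3p/2-1} Γ(p/2) D(p). Then for every 2 < p < 3 and every s ≥ 2, F(p,s) ≤ G̃(p,s), i.e. s^{p/2} F(p,s) ≤ 2^{p/2} F(p,2), with equality when s = 2 (since F(p,2) = G̃(p,2)). -/
open MeasureTheory Real Set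
open scoped ENNReal

/-- `𝔧₁(t) = ∑_{k=0}^∞ (-1)^k / (k! (k+1)!) (t/2)^{2k} = 2J₁(t)/t`. -/
noncomputable def jj1 (t : ℝ) : ℝ :=
  ∑' k : ℕ, ((-1 : ℝ) ^ k / ((k.factorial : ℝ) * ((k + 1).factorial : ℝ))) * (t / 2) ^ (2 * k)

/-- `D(p) = Γ(3-p) / (Γ(2-p/2)² Γ(3-p/2))`. -/
noncomputable def Dfun (p : ℝ) : ℝ :=
  Real.Gamma (3 - p) / (Real.Gamma (2 - p / 2) ^ 2 * Real.Gamma (3 - p / 2))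

/-- `G̃(p,s) = s^{-p/2} 2^{3p/2-1} Γ(p/2) D(p)`. -/
noncomputable def Gtilde (p s : ℝ) : ℝ :=
  s ^ (-p / 2) * 2 ^ (3 * p / 2 - 1) * Real.Gamma (p / 2) * Dfun p

/-- The Bessel–Clifford type series `∑ (-x)^k / (k! (k+m)!)`. -/
noncomputable def besselClifford (m : ℕ) (x : ℝ) : ℝ :=
  ∑' k : ℕ, (-x) ^ k / ((k.factorial : ℝ) * ((k + m).factorial : ℝ))

lemma besselClifford_term_norm_le (m k : ℕ) (x : ℝ) :
    ‖(-x) ^ k / ((k.factorial : ℝ) * ((k + m).factorial : ℝ))‖ ≤ |x| ^ k / (k.factorial : ℝ) := by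
  have h1 : (1 : ℝ) ≤ ((k + m).factorial : ℝ) := by exact_mod_cast Nat.succ_le_of_lt (Nat.factorial_pos _)
  have h2 : (0 : ℝ) < (k.factorial : ℝ) := by exact_mod_cast Nat.factorial_pos _
  rw [norm_div, norm_pow, norm_neg, Real.norm_eq_abs, Real.norm_eq_abs,
    abs_of_pos (by positivity : (0 : ℝ) < (k.factorial : ℝ) * ((k + m).factorial : ℝ))]
  gcongr
  nlinarith

lemma summable_norm_besselClifford (m : ℕ) (x : ℝ) :
    Summable fun k : ℕ => ‖(-x) ^ k / ((k.factorial : ℝ) * ((k + m).factorial : ℝ))‖ :=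
  Summable.of_nonneg_of_le (fun _ => norm_nonneg _) (fun k => besselClifford_term_norm_le m k x)
    (Real.summable_pow_div_factorial |x|)

lemma jj1_eq_besselClifford (t : ℝ) : jj1 t = besselClifford 1 (t ^ 2 / 4) := by
  unfold jj1 besselClifford
  congr 1
  ext k
  rw [pow_mul, show (t / 2) ^ 2 = t ^ 2 / 4 by ring, neg_pow (t ^ 2 / 4)]
  ring

lemma hasDerivAt_besselClifford (m : ℕ) (x : ℝ) :
    HasDerivAt (besselClifford m) (-besselClifford (m + 1) x) x := by
  set R : ℝ := |x| + 1
  have hR : 0 < R := by positivity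
  have key : HasDerivAt (besselClifford m)
      (∑' k : ℕ, -((k : ℝ) * (-x) ^ (k - 1)) / ((k.factorial : ℝ) * ((k + m).factorial : ℝ))) x := by
    refine hasDerivAt_tsum_of_isPreconnected
      (g := fun (k : ℕ) y => (-y) ^ k / ((k.factorial : ℝ) * ((k + m).factorial : ℝ)))
      (u := fun k : ℕ => (k : ℝ) * R ^ (k - 1) / (k.factorial : ℝ)) (t := Metric.ball 0 R) (y₀ := 0)
      (g' := fun (k : ℕ) y => -((k : ℝ) * (-y) ^ (k - 1)) / ((k.factorial : ℝ) * ((k + m).factorial : ℝ)))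
      ?_ Metric.isOpen_ball (convex_ball _ _).isPreconnected ?_ ?_ (by simpa using hR)
      (summable_norm_besselClifford m 0).of_norm (by simp [R])
    · rw [← summable_nat_add_iff 1]
      refine (Real.summable_pow_div_factorial R).congr fun k => ?_
      have : (k.factorial : ℝ) ≠ 0 := by exact_mod_cast k.factorial_ne_zero
      rw [Nat.factorial_succ]
      push_cast
      field_simp
    · intro k y _
      have := ((hasDerivAt_neg y).pow k).div_const ((k.factorial : ℝ) * ((k + m).factorial : ℝ))
      convert! this using 1
      simp
    · intro k y hy
      have h1 : (1 : ℝ) ≤ ((k + m).factorial : ℝ) := by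
        exact_mod_cast Nat.succ_le_of_lt (Nat.factorial_pos _)
      have h2 : (0 : ℝ) < (k.factorial : ℝ) := by exact_mod_cast Nat.factorial_pos _
      have hy' : |y| ≤ R := by simpa using (mem_ball_zero_iff.1 hy).le
      rw [norm_div, norm_neg, norm_mul, norm_pow, norm_neg, Real.norm_eq_abs, Real.norm_eq_abs,
        Real.norm_eq_abs, Nat.abs_cast,
        abs_of_pos (by positivity : (0 : ℝ) < (k.factorial : ℝ) * ((k + m).factorial : ℝ))]
      gcongr
      nlinarith
  have hterm : ∀ k : ℕ, -(((k + 1 : ℕ) : ℝ) * (-x) ^ (k + 1 - 1)) /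
      (((k + 1).factorial : ℝ) * ((k + 1 + m).factorial : ℝ)) =
      -((-x) ^ k / ((k.factorial : ℝ) * ((k + (m + 1)).factorial : ℝ))) := by
    intro k
    have h1 : (k.factorial : ℝ) ≠ 0 := by exact_mod_cast k.factorial_ne_zero
    have h2 : ((k + (m + 1)).factorial : ℝ) ≠ 0 := by exact_mod_cast Nat.factorial_ne_zero _
    rw [Nat.factorial_succ k, show k + 1 + m = k + (m + 1) by ring, Nat.add_sub_cancel,
      Nat.cast_mul]
    generalize ((k + (m + 1)).factorial : ℝ) = b at *
    generalize (k.factorial : ℝ) = a at *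
    push_cast
    field_simp
  have hs : Summable fun k : ℕ => -(((k + 1 : ℕ) : ℝ) * (-x) ^ (k + 1 - 1)) /
      (((k + 1).factorial : ℝ) * ((k + 1 + m).factorial : ℝ)) :=
    ((summable_norm_besselClifford (m + 1) x).of_norm.neg).congr fun k => (hterm k).symm
  rw [((summable_nat_add_iff (f := fun k : ℕ => -((k : ℝ) * (-x) ^ (k - 1)) /
      ((k.factorial : ℝ) * ((k + m).factorial : ℝ))) 1).1 hs).tsum_eq_zero_add,
    tsum_congr hterm, tsum_neg] at key
  simp only [Nat.cast_zero, zero_mul, neg_zero, zero_div, zero_add] at key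
  exact key

lemma continuous_besselClifford (m : ℕ) : Continuous (besselClifford m) :=
  continuous_iff_continuousAt.2 fun x => (hasDerivAt_besselClifford m x).continuousAt

lemma continuous_jj1 : Continuous jj1 := by
  simp_rw [funext jj1_eq_besselClifford]
  exact (continuous_besselClifford 1).comp (by fun_prop)

lemma besselClifford_recurrence (m : ℕ) (x : ℝ) :
    x * besselClifford (m + 2) x = (m + 1) * besselClifford (m + 1) x - besselClifford m x := by
  have h0 := (summable_norm_besselClifford m x).of_norm
  have h1 := (summable_norm_besselClifford (m + 1) x).of_norm
  have h2 := (summable_norm_besselClifford (m + 2) x).of_norm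
  have e : (m + 1 : ℝ) * besselClifford (m + 1) x - besselClifford m x =
      ∑' k : ℕ, ((m + 1 : ℝ) * ((-x) ^ k / ((k.factorial : ℝ) * ((k + (m + 1)).factorial : ℝ))) -
        (-x) ^ k / ((k.factorial : ℝ) * ((k + m).factorial : ℝ))) := by
    rw [Summable.tsum_sub (h1.mul_left _) h0, tsum_mul_left]
    rfl
  rw [e, ((h1.mul_left _).sub h0).tsum_eq_zero_add, besselClifford, ← tsum_mul_left]
  have z : ((m + 1 : ℝ) * ((-x) ^ 0 / (((0 : ℕ).factorial : ℝ) * ((0 + (m + 1)).factorial : ℝ))) -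
        (-x) ^ 0 / (((0 : ℕ).factorial : ℝ) * ((0 + m).factorial : ℝ))) = 0 := by
    have : (m.factorial : ℝ) ≠ 0 := by exact_mod_cast m.factorial_ne_zero
    rw [zero_add, zero_add, Nat.factorial_succ m]
    push_cast
    field_simp
    ring
  rw [z, zero_add]
  congr 1
  ext k
  have : (k.factorial : ℝ) ≠ 0 := by exact_mod_cast k.factorial_ne_zero
  have : ((k + m + 1).factorial : ℝ) ≠ 0 := by exact_mod_cast (k + m + 1).factorial_ne_zero
  rw [show k + 1 + (m + 1) = k + m + 1 + 1 by ring, show k + 1 + m = k + m + 1 by ring,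
    show k + (m + 2) = k + m + 1 + 1 by ring, Nat.factorial_succ (k + m + 1), Nat.factorial_succ k]
  push_cast
  field_simp
  ring

/-- Truncation error of the series, once the ratio of consecutive terms is at most `1/2`. -/
lemma abs_besselClifford_sub_sum_le (m N : ℕ) {x : ℝ} (hx : 0 ≤ x)
    (hN : 2 * x ≤ (N + 1) * (N + 1 + m)) :
    |besselClifford m x - ∑ k ∈ Finset.range N, (-x) ^ k / ((k.factorial : ℝ) * ((k + m).factorial : ℝ))|
      ≤ 2 * (x ^ N / ((N.factorial : ℝ) * ((N + m).factorial : ℝ))) := by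
  have hs := summable_norm_besselClifford m x
  rw [besselClifford, ← hs.of_norm.sum_add_tsum_nat_add N, add_sub_cancel_left]
  have hb : ∀ j : ℕ, ‖(-x) ^ (j + N) / (((j + N).factorial : ℝ) * ((j + N + m).factorial : ℝ))‖ ≤
      x ^ N / ((N.factorial : ℝ) * ((N + m).factorial : ℝ)) * (1 / 2) ^ j := by
    intro j
    rw [norm_div, norm_pow, norm_neg, Real.norm_eq_abs, Real.norm_eq_abs, abs_of_nonneg hx,
      abs_of_pos (by positivity)]
    induction j with
    | zero => simp
    | succ j ih =>
      rw [show j + 1 + N = j + N + 1 by ring, show j + N + 1 + m = j + N + m + 1 by ring,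
        Nat.factorial_succ (j + N), Nat.factorial_succ (j + N + m)]
      have hp : (0 : ℝ) < (((j + N).factorial : ℝ) * ((j + N + m).factorial : ℝ)) := by positivity
      have hq : x / (((j + N : ℕ) + 1 : ℝ) * ((j + N + m : ℕ) + 1 : ℝ)) ≤ 1 / 2 := by
        rw [div_le_div_iff₀ (by positivity) (by norm_num)]
        push_cast
        have : (0 : ℝ) ≤ j := by positivity
        have : (0 : ℝ) ≤ N := by positivity
        have : (0 : ℝ) ≤ m := by positivity
        have : ((N : ℝ) + 1) * (N + 1 + m) ≤ ((j : ℝ) + N + 1) * (j + N + m + 1) := by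
          exact mul_le_mul (by linarith) (by linarith) (by positivity) (by positivity)
        linarith
      calc x ^ (j + N + 1) / ((((j + N + 1) * (j + N).factorial : ℕ) : ℝ) *
            (((j + N + m + 1) * (j + N + m).factorial : ℕ) : ℝ))
          = x ^ (j + N) / (((j + N).factorial : ℝ) * ((j + N + m).factorial : ℝ)) *
            (x / (((j + N : ℕ) + 1 : ℝ) * ((j + N + m : ℕ) + 1 : ℝ))) := by
            push_cast
            field_simp
            ring
        _ ≤ (x ^ N / ((N.factorial : ℝ) * ((N + m).factorial : ℝ)) * (1 / 2) ^ j) * (1 / 2) := by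
            gcongr
        _ = _ := by ring
  have hg : HasSum (fun j : ℕ => x ^ N / ((N.factorial : ℝ) * ((N + m).factorial : ℝ)) * (1 / 2 : ℝ) ^ j)
      (x ^ N / ((N.factorial : ℝ) * ((N + m).factorial : ℝ)) * 2) := hasSum_geometric_two.mul_left _
  have := tsum_of_norm_bounded hg hb
  rw [Real.norm_eq_abs] at this
  linarith

lemma antitoneOn_besselClifford {m : ℕ} {b : ℝ}
    (h : ∀ x ∈ Icc 0 b, 0 ≤ besselClifford (m + 1) x) : AntitoneOn (besselClifford m) (Icc 0 b) := by
  refine antitoneOn_of_deriv_nonpos (convex_Icc _ _) (continuous_besselClifford m).continuousOn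
    (fun x _ => (hasDerivAt_besselClifford m x).differentiableAt.differentiableWithinAt) fun x hx => ?_
  rw [(hasDerivAt_besselClifford m x).deriv]
  exact neg_nonpos.2 (h x (interior_subset hx))

lemma besselClifford_nonneg_of_succ {m : ℕ} {b : ℝ} (hb : 0 ≤ b)
    (h : ∀ x ∈ Icc 0 b, 0 ≤ besselClifford (m + 1) x) (h6 : 0 ≤ besselClifford m b) :
    ∀ x ∈ Icc 0 b, 0 ≤ besselClifford m x := fun _ hx =>
  h6.trans (antitoneOn_besselClifford h hx ⟨hb, le_rfl⟩ hx.2)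

lemma besselClifford_five_nonneg : ∀ x ∈ Icc (0 : ℝ) 6, 0 ≤ besselClifford 5 x := by
  rintro x ⟨h0, h6⟩
  have := (abs_le.1 (abs_besselClifford_sub_sum_le 5 3 h0 (by norm_num; linarith))).1
  norm_num [Finset.sum_range_succ, Nat.factorial] at this
  nlinarith [mul_nonneg (sq_nonneg x) (sub_nonneg.2 h6)]

lemma besselClifford_four_nonneg : ∀ x ∈ Icc (0 : ℝ) 6, 0 ≤ besselClifford 4 x := by
  refine besselClifford_nonneg_of_succ (by norm_num) besselClifford_five_nonneg ?_
  have := (abs_le.1 (abs_besselClifford_sub_sum_le 4 5 (x := 6) (by norm_num) (by norm_num))).1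
  norm_num [Finset.sum_range_succ, Nat.factorial] at this
  linarith

lemma besselClifford_three_nonneg : ∀ x ∈ Icc (0 : ℝ) 6, 0 ≤ besselClifford 3 x := by
  refine besselClifford_nonneg_of_succ (by norm_num) besselClifford_four_nonneg ?_
  have := (abs_le.1 (abs_besselClifford_sub_sum_le 3 7 (x := 6) (by norm_num) (by norm_num))).1
  norm_num [Finset.sum_range_succ, Nat.factorial] at this
  linarith

lemma besselClifford_two_nonneg : ∀ x ∈ Icc (0 : ℝ) 6, 0 ≤ besselClifford 2 x := by
  refine besselClifford_nonneg_of_succ (by norm_num) besselClifford_three_nonneg ?_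
  have := (abs_le.1 (abs_besselClifford_sub_sum_le 2 8 (x := 6) (by norm_num) (by norm_num))).1
  norm_num [Finset.sum_range_succ, Nat.factorial] at this
  linarith

lemma antitone_besselClifford_energy :
    AntitoneOn (fun x => besselClifford 1 x ^ 2 + x * besselClifford 2 x ^ 2) (Ici 0) := by
  have hd : ∀ x, HasDerivAt (fun x => besselClifford 1 x ^ 2 + x * besselClifford 2 x ^ 2)
      (-3 * besselClifford 2 x ^ 2) x := by
    intro x
    have h1 := hasDerivAt_besselClifford 1 x
    have h2 := hasDerivAt_besselClifford 2 x
    convert! (h1.pow 2).add ((hasDerivAt_id x).mul (h2.pow 2)) using 1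
    have := besselClifford_recurrence 1 x
    norm_num at this ⊢
    linear_combination (2 * besselClifford 2 x) * this
  refine antitoneOn_of_deriv_nonpos (convex_Ici _) (fun x _ => (hd x).continuousAt.continuousWithinAt)
    (fun x _ => (hd x).differentiableAt.differentiableWithinAt) fun x _ => ?_
  rw [(hd x).deriv]
  nlinarith [sq_nonneg (besselClifford 2 x)]

lemma exp_neg_two_gt : 0.1353 < rexp (-2) := by
  rw [show (-2 : ℝ) = -1 + -1 by norm_num, Real.exp_add]
  have := Real.exp_neg_one_gt_d9
  nlinarith

lemma abs_besselClifford_one_le_exp_neg_two {x : ℝ} (hx : 68 / 25 ≤ x) :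
    |besselClifford 1 x| ≤ rexp (-2) := by
  have h6 := abs_le.1 (abs_besselClifford_sub_sum_le 1 10 (x := 6) (by norm_num) (by norm_num))
  norm_num [Finset.sum_range_succ, Nat.factorial] at h6
  have he := exp_neg_two_gt
  rcases le_total x 6 with h | h
  · have h0 := abs_le.1
      (abs_besselClifford_sub_sum_le 1 7 (x := 68 / 25) (by norm_num) (by norm_num))
    norm_num [Finset.sum_range_succ, Nat.factorial] at h0
    have ha := antitoneOn_besselClifford besselClifford_two_nonneg
    have h1 := ha ⟨by norm_num, by norm_num⟩ ⟨by linarith, h⟩ hx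
    have h2 := ha ⟨by linarith, h⟩ ⟨by norm_num, le_rfl⟩ h
    rw [abs_le]
    constructor <;> linarith
  · have h2 := abs_le.1 (abs_besselClifford_sub_sum_le 2 8 (x := 6) (by norm_num) (by norm_num))
    norm_num [Finset.sum_range_succ, Nat.factorial] at h2
    have hE := antitone_besselClifford_energy (show (6 : ℝ) ∈ Ici 0 by norm_num)
      (show x ∈ Ici 0 from by simp; linarith) h
    simp only at hE
    have e1 : besselClifford 1 6 ^ 2 ≤ 0.1300 ^ 2 := by
      apply sq_le_sq' <;> norm_num <;> linarith
    have e2 : besselClifford 2 6 ^ 2 ≤ 0.0150 ^ 2 := by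
      apply sq_le_sq' <;> norm_num <;> linarith
    refine abs_le_of_sq_le_sq ?_ (by positivity)
    nlinarith [mul_nonneg (show (0 : ℝ) ≤ x by linarith) (sq_nonneg (besselClifford 2 x))]

lemma abs_besselClifford_one_le_exp {x : ℝ} (h0 : 0 ≤ x) (hx : x ≤ 68 / 25) :
    |besselClifford 1 x| ≤ rexp (-x / 2) := by
  have hd : ∀ y, HasDerivAt (fun x => besselClifford 1 x * rexp (x / 2))
      (-(y / 2 * besselClifford 3 y * rexp (y / 2))) y := by
    intro y
    convert! (hasDerivAt_besselClifford 1 y).mul (((hasDerivAt_id y).div_const 2).exp) using 1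
    have := besselClifford_recurrence 1 y
    norm_num at this ⊢
    linear_combination (-1 / 2 * rexp (y / 2)) * this
  have ha : AntitoneOn (fun x => besselClifford 1 x * rexp (x / 2)) (Icc 0 (68 / 25)) := by
    refine antitoneOn_of_deriv_nonpos (convex_Icc _ _)
      (fun x _ => (hd x).continuousAt.continuousWithinAt)
      (fun x _ => (hd x).differentiableAt.differentiableWithinAt) fun y hy => ?_
    have hy := interior_subset hy
    rw [(hd y).deriv]
    have := besselClifford_three_nonneg y ⟨hy.1, by linarith [hy.2]⟩
    have := hy.1
    exact neg_nonpos.2 (by positivity)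
  have hb0 : besselClifford 1 0 = 1 := by
    have := abs_besselClifford_sub_sum_le 1 1 (x := 0) le_rfl (by norm_num)
    norm_num [Nat.factorial] at this
    linarith
  have h1 := ha ⟨le_rfl, by norm_num⟩ ⟨h0, hx⟩ h0
  simp only [hb0, zero_div, Real.exp_zero, mul_one] at h1
  have hpos : 0 ≤ besselClifford 1 x := by
    have h0' := abs_le.1
      (abs_besselClifford_sub_sum_le 1 7 (x := 68 / 25) (by norm_num) (by norm_num))
    norm_num [Finset.sum_range_succ, Nat.factorial] at h0'
    have := antitoneOn_besselClifford besselClifford_two_nonneg ⟨h0, by linarith⟩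
      ⟨by norm_num, by norm_num⟩ hx
    linarith
  rw [abs_of_nonneg hpos, neg_div, Real.exp_neg, ← one_div, le_div_iff₀ (Real.exp_pos _)]
  exact h1

lemma integrableOn_beta {α β : ℝ} (hα : 0 < α) (hβ : 0 < β) :
    IntegrableOn (fun u : ℝ => u ^ (α - 1) * (1 - u) ^ (β - 1)) (Ioo 0 1) := by
  have h := ProbabilityTheory.lintegral_betaPDF_eq_one hα hβ
  have hb := ProbabilityTheory.beta_pos hα hβ
  rw [ProbabilityTheory.lintegral_betaPDF] at h
  have h1 : IntegrableOn (fun x : ℝ => 1 / ProbabilityTheory.beta α β * x ^ (α - 1) *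
      (1 - x) ^ (β - 1)) (Ioo 0 1) := by
    refine ⟨by fun_prop, ?_⟩
    rw [hasFiniteIntegral_iff_ofReal, h]
    · exact ENNReal.one_lt_top
    · refine (ae_restrict_mem measurableSet_Ioo).mono fun x hx => ?_
      have := hx.1
      have : 0 ≤ 1 - x := by linarith [hx.2]
      simp only [Pi.zero_apply]
      positivity
  refine (h1.const_mul (ProbabilityTheory.beta α β)).congr (ae_of_all _ fun x => ?_)
  simp only
  field_simp

lemma integral_beta {α β : ℝ} (hα : 0 < α) (hβ : 0 < β) :
    ∫ u in Ioo (0 : ℝ) 1, u ^ (α - 1) * (1 - u) ^ (β - 1) = ProbabilityTheory.beta α β := by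
  have h := ProbabilityTheory.lintegral_betaPDF_eq_one hα hβ
  have hb := ProbabilityTheory.beta_pos hα hβ
  rw [ProbabilityTheory.lintegral_betaPDF, ← ofReal_integral_eq_lintegral_ofReal] at h
  · simp_rw [mul_assoc] at h
    rw [integral_const_mul, ENNReal.ofReal_eq_one] at h
    field_simp at h
    exact h
  · simp_rw [mul_assoc]
    exact (integrableOn_beta hα hβ).const_mul _
  · refine (ae_restrict_mem measurableSet_Ioo).mono fun x hx => ?_
    have := hx.1
    have : 0 ≤ 1 - x := by linarith [hx.2]
    simp only [Pi.zero_apply]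
    positivity

lemma pow_mul_beta_kernel (α β : ℝ) (k : ℕ) {u : ℝ} (hu : u ∈ Ioo (0 : ℝ) 1) :
    u ^ k * (u ^ (α - 1) * (1 - u) ^ (β - 1)) = u ^ (α + k - 1) * (1 - u) ^ (β - 1) := by
  rw [← mul_assoc, ← Real.rpow_natCast, ← Real.rpow_add hu.1]
  ring_nf

lemma hasSum_mul_beta {α β : ℝ} (hα : 0 < α) (hβ : 0 < β) {c : ℕ → ℝ}
    (hc : Summable fun k => |c k|) :
    HasSum (fun k : ℕ => c k * ProbabilityTheory.beta (α + k) β)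
      (∫ u in Ioo (0 : ℝ) 1, (∑' k, c k * u ^ k) * (u ^ (α - 1) * (1 - u) ^ (β - 1))) := by
  have hk : ∀ k : ℕ, 0 < α + k := fun k => by positivity
  have e : ∀ k : ℕ, ∀ u ∈ Ioo (0 : ℝ) 1, c k * u ^ k * (u ^ (α - 1) * (1 - u) ^ (β - 1)) =
      c k * (u ^ (α + k - 1) * (1 - u) ^ (β - 1)) := fun k u hu => by
    rw [mul_assoc, pow_mul_beta_kernel α β k hu]
  have hint : ∀ k : ℕ, IntegrableOn
      (fun u : ℝ => c k * u ^ k * (u ^ (α - 1) * (1 - u) ^ (β - 1))) (Ioo 0 1) := fun k =>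
    IntegrableOn.congr_fun ((integrableOn_beta (hk k) hβ).const_mul (c k))
      (fun u hu => (e k u hu).symm) measurableSet_Ioo
  have := hasSum_integral_of_summable_integral_norm (μ := volume.restrict (Ioo (0 : ℝ) 1)) hint ?_
  · simp_rw [tsum_mul_right] at this
    convert! this using 2 with k
    rw [setIntegral_congr_fun measurableSet_Ioo (e k), integral_const_mul, integral_beta (hk k) hβ]
  · refine Summable.of_nonneg_of_le (fun k => integral_nonneg fun _ => norm_nonneg _) (fun k => ?_)
      (hc.mul_right (ProbabilityTheory.beta α β))
    rw [← integral_beta hα hβ, ← integral_const_mul]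
    refine setIntegral_mono_on (hint k).norm ((integrableOn_beta hα hβ).const_mul _)
      measurableSet_Ioo fun u hu => ?_
    have h0 := hu.1.le
    have h1 : 0 ≤ 1 - u := by linarith [hu.2]
    have h2 : u ^ k ≤ 1 := pow_le_one₀ h0 hu.2.le
    rw [Real.norm_eq_abs, abs_mul, abs_mul, abs_of_nonneg (by positivity : 0 ≤ u ^ k),
      abs_of_nonneg (by positivity : 0 ≤ u ^ (α - 1) * (1 - u) ^ (β - 1))]
    gcongr
    exact mul_le_of_le_one_right (abs_nonneg _) h2

lemma beta_half_eq_centralBinom (k : ℕ) :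
    ProbabilityTheory.beta (3 / 2 + k) (1 / 2) = π * (k + 1).centralBinom / 4 ^ (k + 1) := by
  induction k with
  | zero =>
    have h : Real.Gamma (3 / 2) = 1 / 2 * √π := by
      rw [show (3 / 2 : ℝ) = 1 / 2 + 1 by norm_num, Real.Gamma_add_one (by norm_num),
        Real.Gamma_one_half_eq]
    have h2 : Real.Gamma 2 = 1 := by simp
    norm_num [ProbabilityTheory.beta, h, h2, Nat.centralBinom, Nat.choose]
    rw [Real.Gamma_one_half_eq, mul_assoc,
      Real.mul_self_sqrt Real.pi_pos.le]
    ring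
  | succ k ih =>
    have hr : ((k + 1 + 1 : ℕ) : ℝ) * ((k + 1 + 1).centralBinom : ℝ) =
        2 * (2 * ((k + 1 : ℕ) : ℝ) + 1) * ((k + 1).centralBinom : ℝ) := by
      exact_mod_cast Nat.succ_mul_centralBinom_succ (k + 1)
    have hb : ProbabilityTheory.beta (3 / 2 + (k + 1 : ℕ)) (1 / 2) =
        (3 / 2 + k) / (2 + k) * ProbabilityTheory.beta (3 / 2 + k) (1 / 2) := by
      have h1 : (3 / 2 + k : ℝ) ≠ 0 := by positivity
      have h2 : (2 + k : ℝ) ≠ 0 := by positivity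
      unfold ProbabilityTheory.beta
      rw [show (3 / 2 + (k + 1 : ℕ) : ℝ) = (3 / 2 + k) + 1 by push_cast; ring,
        show (3 / 2 + k + 1 + 1 / 2 : ℝ) = (2 + k) + 1 by ring,
        show (3 / 2 + k + 1 / 2 : ℝ) = 2 + k by ring,
        Real.Gamma_add_one h1, Real.Gamma_add_one h2]
      have : Real.Gamma (2 + k) ≠ 0 := (Real.Gamma_pos_of_pos (by positivity)).ne'
      field_simp
    rw [hb, ih]
    push_cast at hr
    have h2 : (2 + k : ℝ) ≠ 0 := by positivity
    field_simp
    linear_combination (-8 * 4 ^ k) * hr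

lemma jj1_sq_eq_tsum (t : ℝ) : jj1 t ^ 2 = ∑' k : ℕ,
    (-1) ^ k * ((k + 1).centralBinom : ℝ) / ((k.factorial : ℝ) * ((k + 2).factorial : ℝ)) *
      (t ^ 2 / 4) ^ k := by
  rw [jj1_eq_besselClifford, sq, besselClifford]
  rw [tsum_mul_tsum_eq_tsum_sum_antidiagonal_of_summable_norm (summable_norm_besselClifford 1 _)
    (summable_norm_besselClifford 1 _)]
  congr 1
  ext k
  generalize t ^ 2 / 4 = x
  have hv : ((k + 1).centralBinom : ℝ) = ∑ ij ∈ Finset.HasAntidiagonal.antidiagonal k,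
      (k.choose ij.1 : ℝ) * ((k + 2).choose (ij.2 + 1) : ℝ) := by
    rw [Nat.centralBinom, show 2 * (k + 1) = k + (k + 2) by ring, Nat.add_choose_eq,
      Finset.Nat.sum_antidiagonal_succ', Nat.choose_succ_self, zero_mul, zero_add]
    push_cast
    rfl
  rw [hv, Finset.mul_sum, Finset.sum_div, Finset.sum_mul]
  refine Finset.sum_congr rfl fun ij hij => ?_
  obtain ⟨i, j⟩ := ij
  obtain rfl : i + j = k := Finset.HasAntidiagonal.mem_antidiagonal.1 hij
  simp only
  have h1 := Nat.add_choose_mul_factorial_mul_factorial i j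
  have h2 := Nat.add_choose_mul_factorial_mul_factorial (i + 1) (j + 1)
  rw [show i + j + 2 = i + 1 + (j + 1) by ring, Nat.choose_symm_add, ← h1, ← h2, neg_pow x i,
    neg_pow x j, pow_add (-1 : ℝ), pow_add x]
  have c1 : ((i + j).choose j : ℝ) ≠ 0 := by
    exact_mod_cast (Nat.choose_pos (Nat.le_add_left _ _)).ne'
  have c2 : ((i + 1 + (j + 1)).choose (j + 1) : ℝ) ≠ 0 := by
    exact_mod_cast (Nat.choose_pos (Nat.le_add_left _ _)).ne'
  have f1 : (i.factorial : ℝ) ≠ 0 := by exact_mod_cast i.factorial_ne_zero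
  have f2 : (j.factorial : ℝ) ≠ 0 := by exact_mod_cast j.factorial_ne_zero
  have f3 : ((i + 1).factorial : ℝ) ≠ 0 := by exact_mod_cast (i + 1).factorial_ne_zero
  have f4 : ((j + 1).factorial : ℝ) ≠ 0 := by exact_mod_cast (j + 1).factorial_ne_zero
  rw [Nat.cast_mul, Nat.cast_mul, Nat.cast_mul, Nat.cast_mul]
  generalize ((i + 1).factorial : ℝ) = a3 at *
  generalize ((j + 1).factorial : ℝ) = a4 at *
  generalize ((i + 1 + (j + 1)).choose (j + 1) : ℝ) = b2 at *
  field_simp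

open Filter Topology

lemma abs_jj1_le_one (t : ℝ) : |jj1 t| ≤ 1 := by
  rw [jj1_eq_besselClifford]
  have h0 : 0 ≤ t ^ 2 / 4 := by positivity
  rcases le_total (t ^ 2 / 4) (68 / 25) with h | h
  · exact (abs_besselClifford_one_le_exp h0 h).trans (Real.exp_le_one_iff.2 (by linarith))
  · exact (abs_besselClifford_one_le_exp_neg_two h).trans (Real.exp_le_one_iff.2 (by norm_num))

lemma integral_rpow_mul_exp_neg_mul_sq {q b : ℝ} (hq : 0 < q) (hb : 0 < b) :
    ∫ t in Ioi (0 : ℝ), t ^ (q - 1) * rexp (-b * t ^ 2) =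
      b ^ (-(q / 2)) / 2 * Real.Gamma (q / 2) := by
  have := integral_rpow_mul_exp_neg_mul_rpow (p := 2) (q := q - 1) two_pos (by linarith) hb
  simp only [Real.rpow_two, sub_add_cancel] at this
  rw [this, neg_div]
  ring

lemma integrableOn_rpow_mul_exp_neg_mul_sq' {q b : ℝ} (hq : 0 < q) (hb : 0 < b) :
    IntegrableOn (fun t : ℝ => t ^ (q - 1) * rexp (-b * t ^ 2)) (Ioi 0) :=
  integrableOn_rpow_mul_exp_neg_mul_sq hb (by linarith)

/-- The Laplace transform of the beta kernel, with its growth normalised. -/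
lemma rpow_mul_integral_exp_beta {a β z : ℝ} (hβ : 1 < β) (hz : 0 < z) :
    z ^ a * ∫ u in Ioo (0 : ℝ) 1, rexp (-z * u) * (u ^ (a - 1) * (1 - u) ^ (β - 1)) =
      ∫ w in Ioi (0 : ℝ), rexp (-w) * w ^ (a - 1) * (max (1 - w / z) 0) ^ (β - 1) := by
  have e1 : ∫ u in Ioo (0 : ℝ) 1, rexp (-z * u) * (u ^ (a - 1) * (1 - u) ^ (β - 1)) =
      ∫ u in Ioi (0 : ℝ), rexp (-z * u) * (u ^ (a - 1) * (max (1 - u) 0) ^ (β - 1)) := by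
    rw [setIntegral_congr_fun (g := fun u => rexp (-z * u) * (u ^ (a - 1) *
      (max (1 - u) 0) ^ (β - 1))) measurableSet_Ioo]
    · refine (setIntegral_eq_of_subset_of_forall_sdiff_eq_zero measurableSet_Ioi
        Ioo_subset_Ioi_self fun u hu => ?_).symm
      have : 1 ≤ u := by
        by_contra! h
        exact hu.2 ⟨hu.1, h⟩
      rw [max_eq_right (by linarith), Real.zero_rpow (by linarith), mul_zero, mul_zero]
    · intro u hu
      simp only
      rw [max_eq_left (by linarith [hu.2])]
  have e2 := integral_comp_mul_left_Ioi (fun w : ℝ => rexp (-w) * w ^ (a - 1) *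
    (max (1 - w / z) 0) ^ (β - 1)) 0 hz
  rw [mul_zero, smul_eq_mul] at e2
  rw [e1, ← mul_inv_cancel_left₀ hz.ne' (∫ w in Ioi (0 : ℝ), rexp (-w) * w ^ (a - 1) *
    (max (1 - w / z) 0) ^ (β - 1)), ← e2, ← integral_const_mul, ← integral_const_mul]
  refine setIntegral_congr_fun measurableSet_Ioi fun u hu => ?_
  have hu : 0 < u := hu
  rw [mul_div_cancel_left₀ _ hz.ne', Real.mul_rpow hz.le hu.le, Real.rpow_sub_one hz.ne']
  field_simp

lemma integrand_exp_beta_le {a β z w : ℝ} (hβ : 1 < β) (hz : 0 < z) (hw : 0 < w) :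
    ‖rexp (-w) * w ^ (a - 1) * (max (1 - w / z) 0) ^ (β - 1)‖ ≤ rexp (-w) * w ^ (a - 1) := by
  have h1 : (max (1 - w / z) 0) ^ (β - 1) ≤ 1 :=
    Real.rpow_le_one (le_max_right _ _) (max_le (by linarith [div_pos hw hz]) zero_le_one)
      (by linarith)
  have h2 : 0 ≤ (max (1 - w / z) 0) ^ (β - 1) := Real.rpow_nonneg (le_max_right _ _) _
  rw [Real.norm_eq_abs, abs_of_nonneg (by positivity)]
  exact mul_le_of_le_one_right (by positivity) h1

lemma integral_exp_beta_le_Gamma {a β z : ℝ} (ha : 0 < a) (hβ : 1 < β) (hz : 0 < z) :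
    ∫ w in Ioi (0 : ℝ), rexp (-w) * w ^ (a - 1) * (max (1 - w / z) 0) ^ (β - 1) ≤
      Real.Gamma a := by
  rw [Real.Gamma_eq_integral ha]
  refine integral_mono_of_nonneg ?_ (Real.GammaIntegral_convergent ha) ?_
  · refine (ae_restrict_mem measurableSet_Ioi).mono fun w hw => ?_
    have hw : 0 < w := hw
    have h2 : 0 ≤ (max (1 - w / z) 0) ^ (β - 1) := Real.rpow_nonneg (le_max_right _ _) _
    simp only [Pi.zero_apply]
    positivity
  · exact (ae_restrict_mem measurableSet_Ioi).mono fun w hw =>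
      (le_abs_self _).trans (integrand_exp_beta_le hβ hz hw)

lemma tendsto_integral_exp_beta {a β : ℝ} (ha : 0 < a) (hβ : 1 < β) {z : ℕ → ℝ}
    (hz : ∀ n, 0 < z n) (hz' : Tendsto z atTop atTop) :
    Tendsto (fun n => ∫ w in Ioi (0 : ℝ), rexp (-w) * w ^ (a - 1) *
      (max (1 - w / z n) 0) ^ (β - 1)) atTop (𝓝 (Real.Gamma a)) := by
  rw [Real.Gamma_eq_integral ha]
  refine tendsto_integral_of_dominated_convergence _ (fun n => ?_)
    (Real.GammaIntegral_convergent ha)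
    (fun n => (ae_restrict_mem measurableSet_Ioi).mono fun w hw =>
      integrand_exp_beta_le hβ (hz n) hw)
    ((ae_restrict_mem measurableSet_Ioi).mono fun w hw => ?_)
  · exact Measurable.aestronglyMeasurable (by fun_prop)
  · have h1 : Tendsto (fun n => max (1 - w / z n) 0) atTop (𝓝 1) := by
      have := ((tendsto_const_nhds (x := w)).div_atTop hz').const_sub 1
      simpa using this.max (tendsto_const_nhds (x := (0 : ℝ)))
    have h2 := (h1.rpow_const (p := β - 1) (Or.inl one_ne_zero)).const_mul (rexp (-w) * w ^ (a - 1))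
    simpa using h2

lemma integral_beta_exp_tsum {a β z : ℝ} (ha : 0 < a) (hβ : 0 < β) :
    HasSum (fun k : ℕ => (-z) ^ k / (k.factorial : ℝ) * ProbabilityTheory.beta (a + k) β)
      (∫ u in Ioo (0 : ℝ) 1, rexp (-z * u) * (u ^ (a - 1) * (1 - u) ^ (β - 1))) := by
  have hc : Summable fun k : ℕ => |(-z) ^ k / (k.factorial : ℝ)| :=
    (Real.summable_pow_div_factorial (-z)).abs
  convert! hasSum_mul_beta ha hβ hc using 4 with u
  rw [Real.exp_eq_exp_ℝ, NormedSpace.exp_eq_tsum_div]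
  refine tsum_congr fun k => ?_
  rw [mul_pow]
  ring

lemma beta_le_beta_zero {a β : ℝ} (ha : 0 < a) (hβ : 0 < β) (k : ℕ) :
    ProbabilityTheory.beta (a + k) β ≤ ProbabilityTheory.beta a β := by
  have hk : 0 < a + k := by positivity
  rw [← integral_beta ha hβ, ← integral_beta hk hβ]
  refine setIntegral_mono_on (integrableOn_beta hk hβ) (integrableOn_beta ha hβ)
      measurableSet_Ioo fun u hu => ?_
  have h0 := hu.1.le
  have h1 : 0 ≤ 1 - u := by linarith [hu.2]
  rw [← pow_mul_beta_kernel a β k hu]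
  exact mul_le_of_le_one_left (by positivity) (pow_le_one₀ h0 hu.2.le)

lemma summable_beta_coeff {a β : ℝ} (ha : 0 < a) (hβ : 0 < β) (z : ℝ) :
    Summable fun k : ℕ => |(-z) ^ k / (k.factorial : ℝ) * ProbabilityTheory.beta (a + k) β| := by
  refine Summable.of_nonneg_of_le (fun _ => abs_nonneg _) (fun k => ?_)
    ((Real.summable_pow_div_factorial (-z)).abs.mul_right (ProbabilityTheory.beta a β))
  rw [abs_mul, abs_of_pos (ProbabilityTheory.beta_pos (by positivity : 0 < a + k) hβ)]
  exact mul_le_mul_of_nonneg_left (beta_le_beta_zero ha hβ k) (abs_nonneg _)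

/-- Gaussian regularisation of `∫ 𝔧₁² t^{2a-1}`, as a double beta integral. -/
lemma integral_jj1_sq_mul_exp {a z : ℝ} (ha : 0 < a) (ha3 : a < 3) (hz : 0 < z) :
    ∫ t in Ioi (0 : ℝ), jj1 t ^ 2 * (t ^ (2 * a - 1) * rexp (-z⁻¹ * t ^ 2)) =
      2 * z ^ a / (π * Real.Gamma (3 - a)) * ∫ y in Ioo (0 : ℝ) 1,
        (∫ u in Ioo (0 : ℝ) 1, rexp (-(z * y) * u) * (u ^ (a - 1) * (1 - u) ^ (3 - a - 1))) *
          (y ^ ((3 / 2 : ℝ) - 1) * (1 - y) ^ ((1 / 2 : ℝ) - 1)) := by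
  have hβ : 0 < 3 - a := by linarith
  have hG : 0 < Real.Gamma (3 - a) := Real.Gamma_pos_of_pos hβ
  have hs := hasSum_mul_beta (α := 3 / 2) (β := 1 / 2) (by norm_num) (by norm_num)
    (summable_beta_coeff ha hβ z)
  have e : ∀ y : ℝ, ∑' k : ℕ, (-z) ^ k / (k.factorial : ℝ) * ProbabilityTheory.beta (a + k) (3 - a) *
      y ^ k = ∫ u in Ioo (0 : ℝ) 1, rexp (-(z * y) * u) *
        (u ^ (a - 1) * (1 - u) ^ (3 - a - 1)) := fun y => by
    rw [← (integral_beta_exp_tsum (z := z * y) ha hβ).tsum_eq]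
    congr 1
    ext k
    rw [← neg_mul, mul_pow]
    ring
  simp_rw [e] at hs
  have hterm : ∀ k : ℕ, ∫ t in Ioi (0 : ℝ), (-1) ^ k * ((k + 1).centralBinom : ℝ) /
      ((k.factorial : ℝ) * ((k + 2).factorial : ℝ)) * (t ^ 2 / 4) ^ k *
        (t ^ (2 * a - 1) * rexp (-z⁻¹ * t ^ 2)) =
      2 * z ^ a / (π * Real.Gamma (3 - a)) * ((-z) ^ k / (k.factorial : ℝ) *
        ProbabilityTheory.beta (a + k) (3 - a) * ProbabilityTheory.beta (3 / 2 + k) (1 / 2)) := by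
    intro k
    have hak : 0 < a + k := by positivity
    have e1 : ∀ t ∈ Ioi (0 : ℝ), (-1) ^ k * ((k + 1).centralBinom : ℝ) /
        ((k.factorial : ℝ) * ((k + 2).factorial : ℝ)) * (t ^ 2 / 4) ^ k *
          (t ^ (2 * a - 1) * rexp (-z⁻¹ * t ^ 2)) =
        (-1) ^ k * ((k + 1).centralBinom : ℝ) /
          ((k.factorial : ℝ) * ((k + 2).factorial : ℝ)) / 4 ^ k *
          (t ^ (2 * (a + k) - 1) * rexp (-z⁻¹ * t ^ 2)) := by
      intro t ht
      have ht : 0 < t := ht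
      have : t ^ (2 * (a + k) - 1) = (t ^ 2) ^ k * t ^ (2 * a - 1) := by
        rw [← pow_mul, ← Real.rpow_natCast t (2 * k), ← Real.rpow_add ht]
        push_cast
        ring_nf
      rw [this, div_pow]
      ring
    rw [setIntegral_congr_fun measurableSet_Ioi e1, integral_const_mul,
      integral_rpow_mul_exp_neg_mul_sq (by linarith) (inv_pos.2 hz), beta_half_eq_centralBinom,
      ProbabilityTheory.beta, show a + k + (3 - a) = ((k + 2 : ℕ) : ℝ) + 1 by push_cast; ring,
      Real.Gamma_nat_eq_factorial, mul_div_cancel_left₀ (a + (k : ℝ)) two_ne_zero,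
      Real.inv_rpow hz.le, Real.rpow_neg hz.le, inv_inv, Real.rpow_add hz, Real.rpow_natCast,
      neg_pow z, pow_succ]
    have f1 : (k.factorial : ℝ) ≠ 0 := by exact_mod_cast k.factorial_ne_zero
    have f2 : ((k + 2).factorial : ℝ) ≠ 0 := by exact_mod_cast (k + 2).factorial_ne_zero
    generalize ((k + 2).factorial : ℝ) = b at *
    field_simp
    ring
  have hint : ∀ k : ℕ, IntegrableOn (fun t : ℝ => (-1) ^ k * ((k + 1).centralBinom : ℝ) /
      ((k.factorial : ℝ) * ((k + 2).factorial : ℝ)) * (t ^ 2 / 4) ^ k *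
        (t ^ (2 * a - 1) * rexp (-z⁻¹ * t ^ 2))) (Ioi 0) := by
    intro k
    have hak : 0 < a + k := by positivity
    refine IntegrableOn.congr_fun ((integrableOn_rpow_mul_exp_neg_mul_sq'
      (q := 2 * (a + k)) (by linarith) (inv_pos.2 hz)).const_mul ((-1) ^ k *
        ((k + 1).centralBinom : ℝ) / ((k.factorial : ℝ) * ((k + 2).factorial : ℝ)) / 4 ^ k))
      (fun t ht => ?_) measurableSet_Ioi
    have ht : 0 < t := ht
    have : t ^ (2 * (a + k) - 1) = (t ^ 2) ^ k * t ^ (2 * a - 1) := by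
      rw [← pow_mul, ← Real.rpow_natCast t (2 * k), ← Real.rpow_add ht]
      push_cast
      ring_nf
    rw [this, div_pow]
    ring
  have hsum := hasSum_integral_of_summable_integral_norm hint ?_
  · simp_rw [hterm, tsum_mul_right, ← jj1_sq_eq_tsum] at hsum
    exact hsum.unique (hs.mul_left _)
  · refine (hs.summable.mul_left (2 * z ^ a / (π * Real.Gamma (3 - a)))).abs.congr fun k => ?_
    rw [← hterm k]
    have : ∀ t ∈ Ioi (0 : ℝ), ‖(-1) ^ k * ((k + 1).centralBinom : ℝ) /
        ((k.factorial : ℝ) * ((k + 2).factorial : ℝ)) * (t ^ 2 / 4) ^ k *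
          (t ^ (2 * a - 1) * rexp (-z⁻¹ * t ^ 2))‖ = (-1) ^ k * ((-1) ^ k *
        ((k + 1).centralBinom : ℝ) / ((k.factorial : ℝ) * ((k + 2).factorial : ℝ)) *
          (t ^ 2 / 4) ^ k * (t ^ (2 * a - 1) * rexp (-z⁻¹ * t ^ 2))) := by
      intro t ht
      have ht : 0 < t := ht
      have h1 : ((-1 : ℝ) ^ k) * (-1) ^ k = 1 := by rw [← mul_pow]; norm_num
      rw [mul_div_assoc, mul_assoc ((-1) ^ k), mul_assoc ((-1) ^ k), ← mul_assoc ((-1) ^ k)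
        ((-1) ^ k), h1, one_mul, norm_mul, norm_pow, norm_neg, norm_one, one_pow, one_mul,
        Real.norm_eq_abs, abs_of_nonneg (by positivity)]
    have h2 := setIntegral_congr_fun (μ := volume) measurableSet_Ioi this
    have h3 := integral_nonneg (μ := volume.restrict (Ioi (0 : ℝ))) (f := fun t => ‖(-1) ^ k *
      ((k + 1).centralBinom : ℝ) / ((k.factorial : ℝ) * ((k + 2).factorial : ℝ)) *
        (t ^ 2 / 4) ^ k * (t ^ (2 * a - 1) * rexp (-z⁻¹ * t ^ 2))‖) fun _ => norm_nonneg _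
    rw [← abs_of_nonneg h3, h2, integral_const_mul, abs_mul, abs_pow, abs_neg, abs_one, one_pow,
      one_mul]

lemma tendsto_integral_jj1_sq_mul_exp {a : ℝ} (ha : 0 < a) (ha' : a < 3 / 2) :
    Tendsto (fun n : ℕ => ∫ t in Ioi (0 : ℝ), jj1 t ^ 2 *
      (t ^ (2 * a - 1) * rexp (-((n : ℝ) + 1)⁻¹ * t ^ 2))) atTop
      (𝓝 (2 / (π * Real.Gamma (3 - a)) *
        (Real.Gamma a * ProbabilityTheory.beta (3 / 2 - a) (1 / 2)))) := by
  have hβ : 1 < 3 - a := by linarith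
  have hz : ∀ n : ℕ, 0 < (n : ℝ) + 1 := fun n => by positivity
  have hα : 0 < 3 / 2 - a := by linarith
  have hh : (0 : ℝ) < 1 / 2 := by norm_num
  have e : ∀ n : ℕ, ∫ t in Ioi (0 : ℝ), jj1 t ^ 2 *
      (t ^ (2 * a - 1) * rexp (-((n : ℝ) + 1)⁻¹ * t ^ 2)) =
      2 / (π * Real.Gamma (3 - a)) * ∫ y in Ioo (0 : ℝ) 1,
        (∫ w in Ioi (0 : ℝ), rexp (-w) * w ^ (a - 1) *
          (max (1 - w / (((n : ℝ) + 1) * y)) 0) ^ (3 - a - 1)) *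
          (y ^ (3 / 2 - a - 1) * (1 - y) ^ ((1 / 2 : ℝ) - 1)) := fun n => by
    rw [integral_jj1_sq_mul_exp ha (by linarith) (hz n), mul_div_right_comm, mul_assoc,
      ← integral_const_mul]
    congr 1
    refine setIntegral_congr_fun measurableSet_Ioo fun y hy => ?_
    have hy : 0 < y := hy.1
    rw [← rpow_mul_integral_exp_beta hβ (mul_pos (hz n) hy), Real.mul_rpow (hz n).le hy.le,
      show (3 / 2 : ℝ) - 1 = a + (3 / 2 - a - 1) by ring, Real.rpow_add hy]
    ring
  simp_rw [e]
  refine Tendsto.const_mul _ ?_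
  rw [← integral_beta hα hh, ← integral_const_mul]
  refine tendsto_integral_of_dominated_convergence
    (fun y => Real.Gamma a * (y ^ (3 / 2 - a - 1) * (1 - y) ^ ((1 / 2 : ℝ) - 1)))
    (fun n => ?_) ((integrableOn_beta hα hh).const_mul _)
    (fun n => (ae_restrict_mem measurableSet_Ioo).mono fun y hy => ?_)
    ((ae_restrict_mem measurableSet_Ioo).mono fun y hy => ?_)
  · refine AEStronglyMeasurable.mul ?_ (Measurable.aestronglyMeasurable (by fun_prop))
    refine (StronglyMeasurable.integral_prod_right (f := fun (y : ℝ) (w : ℝ) =>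
      rexp (-w) * w ^ (a - 1) * (max (1 - w / (((n : ℝ) + 1) * y)) 0) ^ (3 - a - 1))
      (Measurable.stronglyMeasurable ?_)).aestronglyMeasurable
    fun_prop
  · have hy0 : 0 < y := hy.1
    have hy1 : 0 < 1 - y := by linarith [hy.2]
    have hK : 0 ≤ y ^ (3 / 2 - a - 1) * (1 - y) ^ ((1 / 2 : ℝ) - 1) := by positivity
    rw [norm_mul, Real.norm_of_nonneg hK, Real.norm_of_nonneg]
    · exact mul_le_mul_of_nonneg_right
        (integral_exp_beta_le_Gamma ha hβ (mul_pos (hz n) hy0)) hK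
    · refine setIntegral_nonneg measurableSet_Ioi fun w hw => ?_
      have hw : 0 < w := hw
      exact mul_nonneg (by positivity) (Real.rpow_nonneg (le_max_right _ _) _)
  · have hy0 : 0 < y := hy.1
    refine (tendsto_integral_exp_beta ha hβ (fun n => mul_pos (hz n) hy0) ?_).mul_const _
    exact (tendsto_atTop_add_const_right _ _ tendsto_natCast_atTop_atTop).atTop_mul_const hy0

lemma Gtilde_two {p : ℝ} (hp0 : 0 < p) (hp3 : p < 3) :
    Gtilde p 2 = 2 / (π * Real.Gamma (3 - p / 2)) *
      (Real.Gamma (p / 2) * ProbabilityTheory.beta (3 / 2 - p / 2) (1 / 2)) := by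
  have hd := Real.Gamma_mul_Gamma_add_half (3 / 2 - p / 2)
  rw [show 3 / 2 - p / 2 + 1 / 2 = 2 - p / 2 by ring,
    show 2 * (3 / 2 - p / 2) = 3 - p by ring, show 1 - (3 - p) = p - 2 by ring] at hd
  have h1 : 0 < Real.Gamma (2 - p / 2) := Real.Gamma_pos_of_pos (by linarith)
  have h2 : 0 < Real.Gamma (3 - p / 2) := Real.Gamma_pos_of_pos (by linarith)
  have hπ : 0 < √π := Real.sqrt_pos.2 Real.pi_pos
  have e1 : Real.Gamma (3 / 2 - p / 2) =
      Real.Gamma (3 - p) * 2 ^ (p - 2) * √π / Real.Gamma (2 - p / 2) := by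
    rw [eq_div_iff h1.ne', hd]
  have e2 : (2 : ℝ) ^ (-p / 2) * 2 ^ (3 * p / 2 - 1) = 2 * 2 ^ (p - 2) := by
    rw [← Real.rpow_add two_pos]
    rw [show -p / 2 + (3 * p / 2 - 1) = 1 + (p - 2) by ring, Real.rpow_add two_pos, Real.rpow_one]
  rw [Gtilde, Dfun, e2, ProbabilityTheory.beta, e1, Real.Gamma_one_half_eq,
    show 3 / 2 - p / 2 + 1 / 2 = 2 - p / 2 by ring]
  field_simp
  rw [Real.sq_sqrt Real.pi_pos.le]

lemma integrableOn_jj1_sq_mul_exp {q b : ℝ} (hq : 0 < q) (hb : 0 < b) :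
    IntegrableOn (fun t => jj1 t ^ 2 * (t ^ (q - 1) * rexp (-b * t ^ 2))) (Ioi 0) := by
  refine Integrable.bdd_mul (c := 1) (integrableOn_rpow_mul_exp_neg_mul_sq' hq hb)
    (continuous_jj1.pow 2).aestronglyMeasurable (Eventually.of_forall fun t => ?_)
  rw [norm_pow]
  exact pow_le_one₀ (norm_nonneg _) (abs_jj1_le_one t)

lemma lintegral_jj1_sq {p : ℝ} (hp0 : 0 < p) (hp3 : p < 3) :
    ∫⁻ t in Ioi (0 : ℝ), ENNReal.ofReal (jj1 t ^ 2 * t ^ (p - 1)) =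
      ENNReal.ofReal (Gtilde p 2) := by
  set f : ℕ → ℝ → ℝ := fun n t =>
    jj1 t ^ 2 * (t ^ (p - 1) * rexp (-((n : ℝ) + 1)⁻¹ * t ^ 2)) with hf
  have hz : ∀ n : ℕ, 0 < (n : ℝ) + 1 := fun n => by positivity
  have hlim := tendsto_integral_jj1_sq_mul_exp (a := p / 2) (by linarith) (by linarith)
  rw [← Gtilde_two hp0 hp3, mul_div_cancel₀ p two_ne_zero] at hlim
  have h0 : ∀ n : ℕ, ∀ t ∈ Ioi (0 : ℝ), 0 ≤ f n t := fun n t ht => by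
    have ht : 0 < t := ht
    positivity
  have e : ∀ n, ∫⁻ t in Ioi (0 : ℝ), ENNReal.ofReal (f n t) =
      ENNReal.ofReal (∫ t in Ioi (0 : ℝ), f n t) := fun n =>
    (ofReal_integral_eq_lintegral_ofReal (integrableOn_jj1_sq_mul_exp hp0 (inv_pos.2 (hz n)))
      ((ae_restrict_mem measurableSet_Ioi).mono (h0 n))).symm
  have hlim' := (ENNReal.continuous_ofReal.tendsto _).comp hlim
  refine tendsto_nhds_unique ?_ hlim'
  refine (lintegral_tendsto_of_tendsto_of_monotone (f := fun n t => ENNReal.ofReal (f n t))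
    (fun n => ?_) ?_ ?_).congr e
  · exact (ENNReal.measurable_ofReal.comp (continuous_jj1.measurable.pow_const 2 |>.mul
      (by fun_prop))).aemeasurable
  · refine (ae_restrict_mem measurableSet_Ioi).mono fun t ht m n hmn => ?_
    have ht : 0 < t := ht
    refine ENNReal.ofReal_le_ofReal ?_
    have : ((n : ℝ) + 1)⁻¹ ≤ ((m : ℝ) + 1)⁻¹ := by gcongr
    simp only [hf]
    gcongr
  · refine Eventually.of_forall fun t => (ENNReal.continuous_ofReal.tendsto _).comp ?_
    have h1 : Tendsto (fun n : ℕ => rexp (-((n : ℝ) + 1)⁻¹ * t ^ 2)) atTop (𝓝 1) := by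
      have h2 : Tendsto (fun n : ℕ => ((n : ℝ) + 1)⁻¹) atTop (𝓝 0) :=
        tendsto_inv_atTop_zero.comp
          (tendsto_atTop_add_const_right _ _ tendsto_natCast_atTop_atTop)
      have := (Real.continuous_exp.tendsto _).comp (h2.neg.mul_const (t ^ 2))
      simpa [Function.comp_def] using this
    simpa [hf, mul_assoc] using (h1.const_mul (t ^ (p - 1))).const_mul (jj1 t ^ 2)

lemma one_le_Dfun {p : ℝ} (hp2 : 2 < p) (hp3 : p < 3) : 1 ≤ Dfun p := by
  have h1 : 0 < Real.Gamma (2 - p / 2) := Real.Gamma_pos_of_pos (by linarith)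
  have h2 : 0 < Real.Gamma (3 - p / 2) := Real.Gamma_pos_of_pos (by linarith)
  have h3 : 0 < Real.Gamma (3 - p) := Real.Gamma_pos_of_pos (by linarith)
  have h4 : Real.Gamma (2 - p / 2) ^ 2 ≤ Real.Gamma (3 - p) := by
    have := Real.Gamma_mul_add_mul_le_rpow_Gamma_mul_rpow_Gamma (s := 3 - p) (t := 1)
      (a := 1 / 2) (b := 1 / 2) (by linarith) one_pos (by norm_num) (by norm_num) (by norm_num)
    rw [show 1 / 2 * (3 - p) + 1 / 2 * 1 = 2 - p / 2 by ring, Real.Gamma_one, Real.one_rpow,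
      mul_one, ← Real.sqrt_eq_rpow] at this
    exact (Real.le_sqrt h1.le h3.le).1 this
  have h5 : Real.Gamma (3 - p / 2) ≤ 1 := by
    have := Real.convexOn_Gamma.2 (mem_Ioi.2 one_pos) (mem_Ioi.2 two_pos)
      (show 0 ≤ p / 2 - 1 by linarith) (show 0 ≤ 2 - p / 2 by linarith) (by ring)
    simp only [smul_eq_mul, Real.Gamma_one, Real.Gamma_two] at this
    rwa [show (p / 2 - 1) * 1 + (2 - p / 2) * 2 = 3 - p / 2 by ring,
      show (p / 2 - 1) * 1 + (2 - p / 2) * 1 = 1 by ring] at this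
  rw [Dfun, one_le_div (by positivity)]
  exact (mul_le_of_le_one_right (by positivity) h5).trans h4

lemma hasDerivAt_cube_mul_exp {b : ℝ} (hb : 0 < b) (t : ℝ) :
    HasDerivAt (fun t : ℝ => -(1 / (2 * b ^ 2)) * ((b * t ^ 2 + 1) * rexp (-b * t ^ 2)))
      (t ^ 3 * rexp (-b * t ^ 2)) t := by
  have h := (hasDerivAt_pow 2 t).const_mul (-b)
  have h' := ((hasDerivAt_pow 2 t).const_mul b).add_const 1
  refine ((h'.mul h.exp).const_mul (-(1 / (2 * b ^ 2)))).congr_deriv ?_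
  push_cast
  field_simp
  ring

lemma tendsto_cube_mul_exp {b : ℝ} (hb : 0 < b) :
    Tendsto (fun t : ℝ => -(1 / (2 * b ^ 2)) * ((b * t ^ 2 + 1) * rexp (-b * t ^ 2))) atTop
      (𝓝 0) := by
  have h1 : Tendsto (fun t : ℝ => b * t ^ 2) atTop atTop :=
    (tendsto_pow_atTop two_ne_zero).const_mul_atTop hb
  have h2 := ((Real.tendsto_pow_mul_exp_neg_atTop_nhds_zero 1).add
    (Real.tendsto_pow_mul_exp_neg_atTop_nhds_zero 0)).comp h1
  convert h2.const_mul (-(1 / (2 * b ^ 2))) using 2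
  · simp [add_mul]
  · simp

lemma integrableOn_cube_mul_exp {b r : ℝ} (hb : 0 < b) (hr : 0 ≤ r) :
    IntegrableOn (fun t : ℝ => t ^ 3 * rexp (-b * t ^ 2)) (Ioi r) :=
  integrableOn_Ioi_deriv_of_nonneg' (fun t _ => hasDerivAt_cube_mul_exp hb t)
    (fun t ht => by have : 0 < t := hr.trans_lt ht; positivity) (tendsto_cube_mul_exp hb)

lemma integral_cube_mul_exp {b r : ℝ} (hb : 0 < b) (hr : 0 ≤ r) :
    ∫ t in Ioi r, t ^ 3 * rexp (-b * t ^ 2) =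
      1 / (2 * b ^ 2) * ((b * r ^ 2 + 1) * rexp (-b * r ^ 2)) := by
  rw [integral_Ioi_of_hasDerivAt_of_nonneg' (fun t _ => hasDerivAt_cube_mul_exp hb t)
    (fun t ht => by have : 0 < t := hr.trans_lt ht; positivity) (tendsto_cube_mul_exp hb)]
  ring

/-- The difference of Gaussians to which `|𝔧₁|^s - e^{-2(s-2)} 𝔧₁²` is compared. -/
noncomputable def gaussDiff (s t : ℝ) : ℝ :=
  rexp (-(s / 8) * t ^ 2) - rexp (-2 * (s - 2)) * rexp (-(1 / 4) * t ^ 2)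

lemma rpow_sub_eq {s y : ℝ} (hs : 2 ≤ s) (hy : 0 ≤ y) :
    y ^ s - rexp (-2 * (s - 2)) * y ^ 2 = y ^ 2 * (y ^ (s - 2) - rexp (-2) ^ (s - 2)) := by
  have : y ^ s = y ^ 2 * y ^ (s - 2) := by
    rw [← Real.rpow_two, ← Real.rpow_add_of_nonneg hy two_pos.le (by linarith)]
    congr 1; ring
  rw [this, Real.exp_mul]
  ring

lemma rpow_sub_nonpos {s y : ℝ} (hs : 2 ≤ s) (hy : 0 ≤ y) (hy' : y ≤ rexp (-2)) :
    y ^ s - rexp (-2 * (s - 2)) * y ^ 2 ≤ 0 := by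
  rw [rpow_sub_eq hs hy]
  exact mul_nonpos_of_nonneg_of_nonpos (sq_nonneg y)
    (sub_nonpos.2 (Real.rpow_le_rpow hy hy' (by linarith)))

lemma rpow_sub_nonneg {s y : ℝ} (hs : 2 ≤ s) (hy' : rexp (-2) ≤ y) :
    0 ≤ y ^ s - rexp (-2 * (s - 2)) * y ^ 2 := by
  rw [rpow_sub_eq hs ((Real.exp_pos _).le.trans hy')]
  exact mul_nonneg (sq_nonneg y)
    (sub_nonneg.2 (Real.rpow_le_rpow (Real.exp_pos _).le hy' (by linarith)))

lemma rpow_sub_mono {s x y : ℝ} (hs : 2 ≤ s) (hx : rexp (-2) ≤ x) (hxy : x ≤ y) :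
    x ^ s - rexp (-2 * (s - 2)) * x ^ 2 ≤ y ^ s - rexp (-2 * (s - 2)) * y ^ 2 := by
  have hx0 : 0 ≤ x := (Real.exp_pos _).le.trans hx
  have hs' : 0 ≤ s - 2 := by linarith
  rw [rpow_sub_eq hs hx0, rpow_sub_eq hs (hx0.trans hxy)]
  have := sub_nonneg.2 (Real.rpow_le_rpow (Real.exp_pos _).le hx hs')
  gcongr

lemma gaussDiff_eq (s t : ℝ) : gaussDiff s t =
    rexp (-(t ^ 2 / 8)) ^ s - rexp (-2 * (s - 2)) * rexp (-(t ^ 2 / 8)) ^ 2 := by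
  rw [gaussDiff, ← Real.exp_mul, ← Real.exp_nat_mul]
  push_cast
  ring_nf

lemma gaussDiff_nonneg {s t : ℝ} (hs : 2 ≤ s) (ht : t ^ 2 ≤ 16) : 0 ≤ gaussDiff s t := by
  rw [gaussDiff_eq]
  exact rpow_sub_nonneg hs (Real.exp_le_exp.2 (by linarith))

lemma gaussDiff_nonpos {s t : ℝ} (hs : 2 ≤ s) (ht : 16 ≤ t ^ 2) : gaussDiff s t ≤ 0 := by
  rw [gaussDiff_eq]
  exact rpow_sub_nonpos hs (Real.exp_pos _).le (Real.exp_le_exp.2 (by linarith))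

lemma abs_jj1_rpow_sub_le_gaussDiff {s t : ℝ} (hs : 2 ≤ s) (ht : t ^ 2 ≤ 272 / 25) :
    |jj1 t| ^ s - rexp (-2 * (s - 2)) * jj1 t ^ 2 ≤ gaussDiff s t := by
  rw [← sq_abs (jj1 t)]
  rcases le_total (|jj1 t|) (rexp (-2)) with h | h
  · exact (rpow_sub_nonpos hs (abs_nonneg _) h).trans (gaussDiff_nonneg hs (by linarith))
  · rw [gaussDiff_eq]
    refine rpow_sub_mono hs h ?_
    rw [jj1_eq_besselClifford]
    refine (abs_besselClifford_one_le_exp (by positivity) (by linarith)).trans_eq ?_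
    congr 1; ring

lemma abs_jj1_rpow_sub_nonpos {s t : ℝ} (hs : 2 ≤ s) (ht : 272 / 25 ≤ t ^ 2) :
    |jj1 t| ^ s - rexp (-2 * (s - 2)) * jj1 t ^ 2 ≤ 0 := by
  rw [← sq_abs (jj1 t)]
  refine rpow_sub_nonpos hs (abs_nonneg _) ?_
  rw [jj1_eq_besselClifford]
  exact abs_besselClifford_one_le_exp_neg_two (by linarith)

lemma cube_mul_gaussDiff_le {p s t : ℝ} (hp : p ≤ 4) (hs : 2 ≤ s) (ht : 0 < t) :
    4 ^ (p - 4) * (t ^ 3 * gaussDiff s t) ≤ gaussDiff s t * t ^ (p - 1) := by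
  have e : t ^ (p - 1) = t ^ (p - 4) * t ^ 3 := by
    rw [← Real.rpow_natCast, ← Real.rpow_add ht]
    congr 1; push_cast; ring
  have h3 : 0 < t ^ 3 := by positivity
  suffices 0 ≤ (t ^ (p - 4) - 4 ^ (p - 4)) * gaussDiff s t by
    rw [e]; nlinarith [mul_nonneg h3.le this]
  rcases le_total t 4 with h | h
  · exact mul_nonneg (sub_nonneg.2 (Real.rpow_le_rpow_of_nonpos ht h (by linarith)))
      (gaussDiff_nonneg hs (by nlinarith))
  · exact mul_nonneg_of_nonpos_of_nonpos
      (sub_nonpos.2 (Real.rpow_le_rpow_of_nonpos (by norm_num) h (by linarith)))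
      (gaussDiff_nonpos hs (by nlinarith))

lemma integrableOn_cube_mul_gaussDiff {s r : ℝ} (hs : 0 < s) (hr : 0 ≤ r) :
    IntegrableOn (fun t => t ^ 3 * gaussDiff s t) (Ioi r) := by
  have h1 := integrableOn_cube_mul_exp (b := s / 8) (by linarith) hr
  have h2 := (integrableOn_cube_mul_exp (b := 1 / 4) (by norm_num) hr).const_mul
    (rexp (-2 * (s - 2)))
  refine (h1.sub h2).congr (Eventually.of_forall fun t => ?_)
  simp only [gaussDiff, Pi.sub_apply]
  ring

lemma integral_cube_mul_gaussDiff_nonneg {s r : ℝ} (hs : 2 ≤ s) (hr : 0 ≤ r)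
    (hr2 : r ^ 2 = 272 / 25) : 0 ≤ ∫ t in Ioi r, t ^ 3 * gaussDiff s t := by
  have h1 := integrableOn_cube_mul_exp (b := s / 8) (by linarith) hr
  have h2 := (integrableOn_cube_mul_exp (b := 1 / 4) (by norm_num) hr).const_mul
    (rexp (-2 * (s - 2)))
  have e : ∀ t, t ^ 3 * gaussDiff s t = t ^ 3 * rexp (-(s / 8) * t ^ 2) -
      rexp (-2 * (s - 2)) * (t ^ 3 * rexp (-(1 / 4) * t ^ 2)) := fun t => by
    rw [gaussDiff]; ring
  simp_rw [e]
  rw [integral_sub h1 h2, integral_const_mul, integral_cube_mul_exp (by linarith) hr,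
    integral_cube_mul_exp (by norm_num) hr, hr2, sub_nonneg]
  obtain ⟨d, hd, rfl⟩ : ∃ d, 0 ≤ d ∧ s = 2 + 2 * d := ⟨s / 2 - 1, by linarith, by ring⟩
  have hE : 1 + 32 / 25 * d + (32 / 25 * d) ^ 2 / 2 ≤ rexp (32 / 25 * d) :=
    Real.quadratic_le_exp_of_nonneg (by positivity)
  have e1 : rexp (-((2 + 2 * d) / 8) * (272 / 25)) =
      rexp (32 / 25 * d) * (rexp (-2 * (2 + 2 * d - 2)) * rexp (-(1 / 4) * (272 / 25))) := by
    rw [← Real.exp_add, ← Real.exp_add]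
    ring_nf
  rw [e1]
  have hX : 0 < rexp (-2 * (2 + 2 * d - 2)) * rexp (-(1 / 4) * (272 / 25)) := by positivity
  have key : 8 * (93 / 25) ≤ 1 / (2 * ((2 + 2 * d) / 8) ^ 2) *
      (((2 + 2 * d) / 8 * (272 / 25) + 1) * rexp (32 / 25 * d)) := by
    refine le_trans ?_ (mul_le_mul_of_nonneg_left
      (mul_le_mul_of_nonneg_left hE (by positivity)) (by positivity))
    rw [one_div_mul_eq_div, le_div_iff₀ (by positivity)]
    nlinarith [pow_nonneg hd 3, pow_nonneg hd 2]
  linarith [mul_le_mul_of_nonneg_right key hX.le]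

lemma two_div_rpow_ge {p s : ℝ} (hp0 : 0 ≤ p) (hp : p ≤ 8) (hs : 2 ≤ s) :
    rexp (-2 * (s - 2)) ≤ (2 / s) ^ (p / 2) := by
  rw [Real.rpow_def_of_pos (by positivity), Real.exp_le_exp, ← inv_div, Real.log_inv]
  have h1 := Real.log_le_sub_one_of_pos (show 0 < s / 2 by linarith)
  have h0 := Real.log_nonneg (show 1 ≤ s / 2 by linarith)
  nlinarith

lemma integrableOn_jj1_sq {p : ℝ} (hp0 : 0 < p) (hp3 : p < 3) :
    IntegrableOn (fun t => jj1 t ^ 2 * t ^ (p - 1)) (Ioi 0) := by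
  refine ⟨(continuous_jj1.measurable.pow_const 2 |>.mul
    (by fun_prop)).aestronglyMeasurable, ?_⟩
  rw [hasFiniteIntegral_iff_ofReal ((ae_restrict_mem measurableSet_Ioi).mono fun t ht => by
    have : 0 < t := ht
    simp only [Pi.zero_apply]
    positivity), lintegral_jj1_sq hp0 hp3]
  exact ENNReal.ofReal_lt_top

lemma integral_jj1_sq {p : ℝ} (hp0 : 0 < p) (hp3 : p < 3) :
    ∫ t in Ioi (0 : ℝ), jj1 t ^ 2 * t ^ (p - 1) = Gtilde p 2 := by
  have hG : 0 ≤ Gtilde p 2 := by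
    have h1 : 0 < Real.Gamma (p / 2) := Real.Gamma_pos_of_pos (by linarith)
    have h2 : 0 < Real.Gamma (3 - p / 2) := Real.Gamma_pos_of_pos (by linarith)
    have h3 : 0 < Real.Gamma (3 - p) := Real.Gamma_pos_of_pos (by linarith)
    rw [Gtilde, Dfun]
    positivity
  rw [integral_eq_lintegral_of_nonneg_ae ((ae_restrict_mem measurableSet_Ioi).mono fun t ht => by
    have : 0 < t := ht
    simp only [Pi.zero_apply]
    positivity) (integrableOn_jj1_sq hp0 hp3).aestronglyMeasurable, lintegral_jj1_sq hp0 hp3,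
    ENNReal.toReal_ofReal hG]

lemma integrableOn_abs_jj1_rpow {p s : ℝ} (hp0 : 0 < p) (hp3 : p < 3) (hs : 2 ≤ s) :
    IntegrableOn (fun t => |jj1 t| ^ s * t ^ (p - 1)) (Ioi 0) := by
  refine (integrableOn_jj1_sq hp0 hp3).mono'
    (((continuous_jj1.measurable.abs.pow_const s).mul (by fun_prop)).aestronglyMeasurable)
    ((ae_restrict_mem measurableSet_Ioi).mono fun t ht => ?_)
  have ht : 0 < t := ht
  rw [Real.norm_of_nonneg (by positivity), ← sq_abs (jj1 t), ← Real.rpow_two]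
  gcongr ?_ * _
  exact Real.rpow_le_rpow_of_exponent_ge_of_imp (abs_nonneg _) (abs_jj1_le_one t) hs
    fun _ h => absurd h (by linarith)

lemma Gtilde_eq_two_div_rpow_mul {p s : ℝ} (hs : 0 < s) :
    Gtilde p s = (2 / s) ^ (p / 2) * Gtilde p 2 := by
  have : (2 / s) ^ (p / 2) * 2 ^ (-p / 2) = s ^ (-p / 2) := by
    rw [Real.div_rpow two_pos.le hs.le, neg_div, Real.rpow_neg two_pos.le, Real.rpow_neg hs.le]
    field_simp
  rw [Gtilde, Gtilde, ← this]
  ring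

lemma integrableOn_gaussDiff_mul_rpow {p s : ℝ} (hp : 0 < p) (hs : 0 < s) :
    IntegrableOn (fun t => gaussDiff s t * t ^ (p - 1)) (Ioi 0) := by
  have h1 := integrableOn_rpow_mul_exp_neg_mul_sq' (b := s / 8) hp (by linarith)
  have h2 := (integrableOn_rpow_mul_exp_neg_mul_sq' (b := 1 / 4) hp (by norm_num)).const_mul
    (rexp (-2 * (s - 2)))
  refine (h1.sub h2).congr (Eventually.of_forall fun t => ?_)
  simp only [gaussDiff, Pi.sub_apply]
  ring

lemma integral_gaussDiff_mul_rpow {p s : ℝ} (hp : 0 < p) (hs : 0 < s) :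
    ∫ t in Ioi (0 : ℝ), gaussDiff s t * t ^ (p - 1) =
      ((2 / s) ^ (p / 2) - rexp (-2 * (s - 2))) * (2 ^ (p - 1) * Real.Gamma (p / 2)) := by
  have h1 := integrableOn_rpow_mul_exp_neg_mul_sq' (b := s / 8) hp (by linarith)
  have h2 := (integrableOn_rpow_mul_exp_neg_mul_sq' (b := 1 / 4) hp (by norm_num)).const_mul
    (rexp (-2 * (s - 2)))
  have e : ∀ t, gaussDiff s t * t ^ (p - 1) = t ^ (p - 1) * rexp (-(s / 8) * t ^ 2) -
      rexp (-2 * (s - 2)) * (t ^ (p - 1) * rexp (-(1 / 4) * t ^ 2)) := fun t => by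
    rw [gaussDiff]; ring
  have e4 : (4 : ℝ) ^ (p / 2) = 2 ^ (p - 1) * 2 := by
    rw [show (4 : ℝ) = 2 ^ (2 : ℝ) by norm_num, ← Real.rpow_mul two_pos.le,
      ← Real.rpow_add_one two_ne_zero]
    ring_nf
  simp_rw [e]
  rw [integral_sub h1 h2, integral_const_mul, integral_rpow_mul_exp_neg_mul_sq hp (by linarith),
    integral_rpow_mul_exp_neg_mul_sq hp (by norm_num), Real.rpow_neg (by positivity),
    ← Real.inv_rpow (by positivity), Real.rpow_neg (by positivity),
    ← Real.inv_rpow (by positivity), show (s / 8)⁻¹ = 2 / s * 4 by field_simp; norm_num,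
    Real.mul_rpow (by positivity) (by norm_num), show ((1 : ℝ) / 4)⁻¹ = 4 by norm_num, e4]
  ring

lemma integral_gaussian_le_Gtilde {p : ℝ} (hp2 : 2 < p) (hp3 : p < 3) :
    2 ^ (p - 1) * Real.Gamma (p / 2) ≤ Gtilde p 2 := by
  have h1 : 0 < Real.Gamma (p / 2) := Real.Gamma_pos_of_pos (by linarith)
  have e : (2 : ℝ) ^ (-p / 2) * 2 ^ (3 * p / 2 - 1) = 2 ^ (p - 1) := by
    rw [← Real.rpow_add two_pos]
    ring_nf
  rw [Gtilde, e]
  exact le_mul_of_one_le_right (by positivity) (one_le_Dfun hp2 hp3)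

lemma integral_abs_jj1_rpow_le {p s : ℝ} (hp2 : 2 < p) (hp3 : p < 3) (hs : 2 ≤ s) :
    ∫ t in Ioi (0 : ℝ), |jj1 t| ^ s * t ^ (p - 1) ≤ Gtilde p s := by
  have hp0 : 0 < p := by linarith
  have hs0 : 0 < s := by linarith
  set r : ℝ := √(272 / 25)
  have hr : 0 ≤ r := Real.sqrt_nonneg _
  have hr2 : r ^ 2 = 272 / 25 := Real.sq_sqrt (by norm_num)
  have i1 := (integrableOn_jj1_sq hp0 hp3).const_mul (rexp (-2 * (s - 2)))
  have i2 := integrableOn_gaussDiff_mul_rpow hp0 hs0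
  have i3 : IntegrableOn ((Ioi r).indicator fun t => 4 ^ (p - 4) * (t ^ 3 * gaussDiff s t))
      (Ioi 0) :=
    ((integrableOn_cube_mul_gaussDiff hs0 le_rfl).const_mul _).indicator measurableSet_Ioi
  have key : ∀ t ∈ Ioi (0 : ℝ), |jj1 t| ^ s * t ^ (p - 1) ≤
      rexp (-2 * (s - 2)) * (jj1 t ^ 2 * t ^ (p - 1)) + gaussDiff s t * t ^ (p - 1) -
        (Ioi r).indicator (fun t => 4 ^ (p - 4) * (t ^ 3 * gaussDiff s t)) t := by
    intro t ht
    have ht : 0 < t := ht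
    have hpos : 0 ≤ t ^ (p - 1) := by positivity
    by_cases h : t ∈ Ioi r
    · have h' : 272 / 25 ≤ t ^ 2 := hr2 ▸ pow_le_pow_left₀ hr (le_of_lt h) 2
      rw [indicator_of_mem h]
      have h1 := mul_le_mul_of_nonneg_right (abs_jj1_rpow_sub_nonpos hs h') hpos
      have h2 := cube_mul_gaussDiff_le (p := p) (by linarith) hs ht
      linarith
    · have h' : t ^ 2 ≤ 272 / 25 := hr2 ▸ pow_le_pow_left₀ ht.le (not_lt.1 h) 2
      rw [indicator_of_notMem h]
      have h1 := mul_le_mul_of_nonneg_right (abs_jj1_rpow_sub_le_gaussDiff hs h') hpos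
      linarith
  refine (setIntegral_mono_on (integrableOn_abs_jj1_rpow hp0 hp3 hs) ((i1.add i2).sub i3)
    measurableSet_Ioi key).trans ?_
  have e3 : ∫ t in Ioi (0 : ℝ), (Ioi r).indicator
      (fun t => 4 ^ (p - 4) * (t ^ 3 * gaussDiff s t)) t =
      4 ^ (p - 4) * ∫ t in Ioi r, t ^ 3 * gaussDiff s t := by
    rw [setIntegral_indicator measurableSet_Ioi, Ioi_inter_Ioi, sup_eq_right.2 hr,
      integral_const_mul]
  have h3 : 0 ≤ (4 : ℝ) ^ (p - 4) * ∫ t in Ioi r, t ^ 3 * gaussDiff s t :=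
    mul_nonneg (by positivity) (integral_cube_mul_gaussDiff_nonneg hs hr hr2)
  have e12 := integral_sub (i1.add i2) i3
  simp only [Pi.add_apply] at e12
  simp only [Pi.add_apply, Pi.sub_apply]
  rw [e12, integral_add i1 i2, integral_const_mul, integral_jj1_sq hp0 hp3, e3,
    integral_gaussDiff_mul_rpow hp0 hs0, Gtilde_eq_two_div_rpow_mul hs0]
  have h4 := mul_le_mul_of_nonneg_left (integral_gaussian_le_Gtilde hp2 hp3)
    (sub_nonneg.2 (two_div_rpow_ge hp0.le (by linarith : p ≤ 8) hs))
  linarith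

/-- For `2 < p < 3` and `s ≥ 2`: `F(p,s) ≤ G̃(p,s)` where
`F(p,s) = ∫_0^∞ |𝔧₁(t)|^s t^{p-1} dt`, with equality at `s = 2` since
`F(p,2) = G̃(p,2)`. -/
theorem F_le_Gtilde (p s : ℝ) (hp2 : 2 < p) (hp3 : p < 3) (hs : 2 ≤ s) :
    (∫⁻ t in Set.Ioi (0 : ℝ), ENNReal.ofReal (|jj1 t| ^ s * t ^ (p - 1))
        ≤ ENNReal.ofReal (Gtilde p s))
    ∧ (∫⁻ t in Set.Ioi (0 : ℝ), ENNReal.ofReal (|jj1 t| ^ (2 : ℝ) * t ^ (p - 1))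
        = ENNReal.ofReal (Gtilde p 2)) := by
  constructor
  · rw [← ofReal_integral_eq_lintegral_ofReal
      (integrableOn_abs_jj1_rpow (by linarith) hp3 hs)
      ((ae_restrict_mem measurableSet_Ioi).mono fun t ht => by
        have : 0 < t := ht
        simp only [Pi.zero_apply]
        positivity)]
    exact ENNReal.ofReal_le_ofReal (integral_abs_jj1_rpow_le hp2 hp3 hs)
  · simp_rw [Real.rpow_two, sq_abs]
    exact lintegral_jj1_sq (by linarith) hp3
end

section
/- Define D(p) = Γ(3-p) / ( Γ(2 - p/2)² Γ(3 - p/2) ). Then the function p ↦ log D(p) is strictly increasing, convex, and positive on the interval (2,3); in particular D(p) > 1 for all 2 < p < 3. -/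
open Real Set

open Filter Topology

/-- A pointwise limit of convex functions is convex. -/
lemma convexOn_of_forall_tendsto {s : Set ℝ} {F : ℕ → ℝ → ℝ} {f : ℝ → ℝ}
    (hs : Convex ℝ s) (hF : ∀ n, ConvexOn ℝ s (F n))
    (hlim : ∀ x ∈ s, Tendsto (fun n => F n x) atTop (𝓝 (f x))) : ConvexOn ℝ s f := by
  refine ⟨hs, fun x hx y hy a b ha hb hab => ?_⟩
  exact le_of_tendsto_of_tendsto' (hlim _ (hs hx hy ha hb hab))
    (((hlim x hx).const_smul a).add ((hlim y hy).const_smul b))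
    fun n => (hF n).2 hx hy ha hb hab

lemma convexOn_finset_sum {ι : Type*} {s : Set ℝ} (hs : Convex ℝ s) (t : Finset ι)
    {f : ι → ℝ → ℝ} (hf : ∀ i ∈ t, ConvexOn ℝ s (f i)) :
    ConvexOn ℝ s (fun x => ∑ i ∈ t, f i x) := by
  classical
  induction t using Finset.induction_on with
  | empty => simpa using convexOn_const (0 : ℝ) hs
  | insert i t hi ih =>
    simp_rw [Finset.sum_insert hi]
    exact (hf i (Finset.mem_insert_self i t)).add
      (ih fun j hj => hf j (Finset.mem_insert_of_mem hj))

lemma convexOn_neg_log_two_sub_half :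
    ConvexOn ℝ (Ico 2 3) (fun p : ℝ => -Real.log (2 - p / 2)) := by
  refine ⟨convex_Ico 2 3, fun x hx y hy a b ha hb hab => ?_⟩
  have h := strictConcaveOn_log_Ioi.concaveOn.2
    (show 2 - x / 2 ∈ Ioi (0 : ℝ) by simp only [mem_Ioi]; linarith [hx.2])
    (show 2 - y / 2 ∈ Ioi (0 : ℝ) by simp only [mem_Ioi]; linarith [hy.2]) ha hb hab
  simp only [smul_eq_mul] at h ⊢
  have e : a * (2 - x / 2) + b * (2 - y / 2) = 2 - (a * x + b * y) / 2 := by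
    linear_combination 2 * hab
  rw [e] at h
  linarith

lemma convexOn_three_mul_log_sub_log (m : ℕ) :
    ConvexOn ℝ (Ico 2 3)
      (fun p : ℝ => 3 * Real.log (2 - p / 2 + m) - Real.log (3 - p + m)) := by
  have hm : (0 : ℝ) ≤ m := m.cast_nonneg
  have hu (p : ℝ) : HasDerivAt (fun p : ℝ => 2 - p / 2 + m) (-(1 / 2)) p :=
    (((hasDerivAt_id p).div_const 2).const_sub 2).add_const _
  have hv (p : ℝ) : HasDerivAt (fun p : ℝ => 3 - p + m) (-1) p :=
    ((hasDerivAt_id p).const_sub 3).add_const _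
  have hu0 {p : ℝ} (hp : p < 3) : 0 < 2 - p / 2 + m := by linarith
  have hv0 {p : ℝ} (hp : p < 3) : 0 < 3 - p + m := by linarith
  have h1 {p : ℝ} (hp : p < 3) :=
    (((hu p).log (hu0 hp).ne').const_mul 3).sub ((hv p).log (hv0 hp).ne')
  refine convexOn_of_hasDerivWithinAt2_nonneg (convex_Ico 2 3)
    (f' := fun p => 3 * (-(1 / 2) / (2 - p / 2 + m)) - -1 / (3 - p + m))
    (f'' := fun p => 1 / (3 - p + m) ^ 2 - 3 / 4 / (2 - p / 2 + m) ^ 2)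
    (fun p hp => (h1 hp.2).continuousAt.continuousWithinAt) ?_ ?_ ?_
  all_goals
    rw [interior_Ico]
    intro p hp
    have a := hu0 hp.2
    have b := hv0 hp.2
  · exact (h1 hp.2).hasDerivWithinAt
  · have h2 := ((((hasDerivAt_const p (-(1 / 2) : ℝ)).div (hu p) a.ne').const_mul 3).sub
      ((hasDerivAt_const p (-1 : ℝ)).div (hv p) b.ne')).hasDerivWithinAt (s := Ioo 2 3)
    refine h2.congr_deriv ?_
    ring
  · rw [sub_nonneg, div_le_div_iff₀ (by positivity) (by positivity)]
    nlinarith [hp.1]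

/-- `log D(p)` for `p < 3`, after applying the functional equation of `Γ`. -/
lemma log_Dfun_eq {p : ℝ} (hp : p < 3) :
    Real.log (Dfun p) = Real.log (Real.Gamma (3 - p)) - 3 * Real.log (Real.Gamma (2 - p / 2))
      - Real.log (2 - p / 2) := by
  have h0 : 0 < 2 - p / 2 := by linarith
  have h1 := Real.Gamma_pos_of_pos (show 0 < 3 - p by linarith)
  have h2 := Real.Gamma_pos_of_pos h0
  rw [Dfun, show 3 - p / 2 = (2 - p / 2) + 1 by ring, Real.Gamma_add_one h0.ne',
    Real.log_div h1.ne' (by positivity), Real.log_mul (by positivity) (by positivity),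
    Real.log_mul h0.ne' h2.ne', Real.log_pow]
  push_cast
  ring

lemma convexOn_log_Dfun : ConvexOn ℝ (Ico 2 3) (fun p => Real.log (Dfun p)) := by
  let S (n : ℕ) (p : ℝ) : ℝ :=
    (∑ m ∈ Finset.range (n + 1), (3 * Real.log (2 - p / 2 + m) - Real.log (3 - p + m)))
      + -Real.log (2 - p / 2) + ((Real.log n / 2) • p + (-3 * Real.log n - 2 * Real.log n.factorial))
  refine convexOn_of_forall_tendsto (F := S) (convex_Ico 2 3) (fun n => ?_) fun p hp => ?_
  · refine ((convexOn_finset_sum (convex_Ico 2 3) _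
      fun m _ => convexOn_three_mul_log_sub_log m).add convexOn_neg_log_two_sub_half).add ?_
    exact (((Real.log n / 2) • (LinearMap.id : ℝ →ₗ[ℝ] ℝ)).convexOn (convex_Ico 2 3)).add_const _
  · have h1 := Real.BohrMollerup.tendsto_log_gamma (show 0 < 3 - p by linarith [hp.2])
    have h2 := Real.BohrMollerup.tendsto_log_gamma (show 0 < 2 - p / 2 by linarith [hp.2])
    rw [log_Dfun_eq hp.2]
    refine ((h1.sub (h2.const_mul 3)).sub_const _).congr fun n => ?_
    simp only [S, Real.BohrMollerup.logGammaSeq, Finset.sum_sub_distrib, ← Finset.mul_sum,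
      smul_eq_mul]
    ring

lemma log_Dfun_two : Real.log (Dfun 2) = 0 := by
  rw [log_Dfun_eq (by norm_num)]
  norm_num

lemma hasDerivAt_log_Dfun_two :
    HasDerivAt (fun p => Real.log (Dfun p)) ((1 - eulerMascheroniConstant) / 2) 2 := by
  have hu : HasDerivAt (fun p : ℝ => 2 - p / 2) (-(1 / 2)) 2 :=
    ((hasDerivAt_id (2 : ℝ)).div_const 2).const_sub 2
  have hv : HasDerivAt (fun p : ℝ => 3 - p) (-1) 2 := (hasDerivAt_id (2 : ℝ)).const_sub 3
  have hG := Real.hasDerivAt_Gamma_one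
  have h1 := (hG.comp_of_eq 2 hv (by norm_num)).log (by norm_num)
  have h2 := (hG.comp_of_eq 2 hu (by norm_num)).log (by norm_num)
  have h3 := (h1.sub (h2.const_mul 3)).sub (hu.log (by norm_num))
  refine (h3.congr_of_eventuallyEq ?_).congr_deriv ?_
  · filter_upwards [eventually_lt_nhds (show (2 : ℝ) < 3 by norm_num)] with p hp
    exact log_Dfun_eq hp
  · norm_num
    ring

lemma log_Dfun_pos {p : ℝ} (hp : p ∈ Ioo (2 : ℝ) 3) : 0 < Real.log (Dfun p) := by
  have h := convexOn_log_Dfun.le_slope_of_hasDerivAt (by norm_num) ⟨hp.1.le, hp.2⟩ hp.1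
    hasDerivAt_log_Dfun_two
  rw [slope_def_field, log_Dfun_two, sub_zero, le_div_iff₀ (sub_pos.2 hp.1)] at h
  refine lt_of_lt_of_le (mul_pos ?_ (sub_pos.2 hp.1)) h
  linarith [Real.eulerMascheroniConstant_lt_two_thirds]

/-- The function `p ↦ log D(p)` is strictly increasing, convex and positive on
`(2,3)`; in particular `D(p) > 1` for all `2 < p < 3`. -/
theorem logD_strictMono_convex_pos :
    StrictMonoOn (fun p => Real.log (Dfun p)) (Set.Ioo 2 3)
    ∧ ConvexOn ℝ (Set.Ioo 2 3) (fun p => Real.log (Dfun p))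
    ∧ (∀ p ∈ Set.Ioo (2 : ℝ) 3, 0 < Real.log (Dfun p) ∧ 1 < Dfun p) := by
  refine ⟨fun x hx y hy hxy => ?_, convexOn_log_Dfun.subset Ioo_subset_Ico_self (convex_Ioo 2 3),
    fun p hp => ⟨log_Dfun_pos hp, ?_⟩⟩
  · have h := convexOn_log_Dfun.slope_mono_adjacent (by norm_num : (2 : ℝ) ∈ Ico 2 3)
      ⟨hy.1.le, hy.2⟩ hx.1 hxy
    rw [log_Dfun_two, sub_zero] at h
    have h' := (div_pos (log_Dfun_pos hx) (sub_pos.2 hx.1)).trans_le h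
    exact sub_pos.1 ((div_pos_iff_of_pos_right (sub_pos.2 hxy)).1 h')
  · have h1 := Real.Gamma_pos_of_pos (show 0 < 3 - p by linarith [hp.2])
    have h2 := Real.Gamma_pos_of_pos (show 0 < 2 - p / 2 by linarith [hp.2])
    have h3 := Real.Gamma_pos_of_pos (show 0 < 3 - p / 2 by linarith [hp.2])
    refine (Real.log_pos_iff ?_).1 (log_Dfun_pos hp)
    unfold Dfun
    positivity
end
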